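/- As n → ∞, the number of plateaux Z_n of a uniformly random Stirling permutation of length 2n is asymptotically normal: the random variables (Z_n - 2n/3)/√n converge in distribution to the centered normal distribution N(0, 1/9). By equidistribution, the same convergence holds for (X_n - 2n/3)/√n and (Y_n - 2n/3)/√n, where X_n and Y_n are the numbers of ascents and descents. -/

import Mathlib

/-- A Stirling permutation of length `2*n`. -/
def IsStirlingPerm (n : ℕ) (l : List ℕ) : Prop :=
  l.length = 2 * n ∧
  (∀ i : ℕ, 1 ≤ i → i ≤ n → l.count i = 2) ∧
  ∀ p q r : Fin l.length, p < q → q < r → l.get p = l.get r → l.get p < l.get q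

/-- The extended sequence `a_0 a_1 … a_{2n} a_{2n+1}` with the convention
`a_0 = a_{2n+1} = 0`: `ext l i = a_i`. -/
def ext (l : List ℕ) (i : ℕ) : ℕ := if i = 0 then 0 else l.getD (i - 1) 0

/-- The number of ascents of `l`: indices `i ∈ {0,…,2n}` with `a_i < a_{i+1}`. -/
def ascents (l : List ℕ) : ℕ :=
  ((Finset.range (l.length + 1)).filter (fun i => ext l i < ext l (i + 1))).card

/-- The number of descents of `l`: indices `i ∈ {0,…,2n}` with `a_i > a_{i+1}`. -/
def descents (l : List ℕ) : ℕ :=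
  ((Finset.range (l.length + 1)).filter (fun i => ext l i > ext l (i + 1))).card

/-- The number of plateaux of `l`: indices `i ∈ {0,…,2n}` with `a_i = a_{i+1}`. -/
def plateaux (l : List ℕ) : ℕ :=
  ((Finset.range (l.length + 1)).filter (fun i => ext l i = ext l (i + 1))).card

open MeasureTheory ProbabilityTheory ENNReal

/-- We endow `List ℕ` (a countable type) with the discrete σ-algebra. -/
instance : MeasurableSpace (List ℕ) := ⊤

/-- The uniform probability measure on the (finite) set of Stirling permutations of
length `2n`. -/
noncomputable def uniformStirling (n : ℕ) : Measure (List ℕ) :=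
  (({l : List ℕ | IsStirlingPerm n l}.ncard : ℝ≥0∞))⁻¹
    • (Measure.count.restrict {l : List ℕ | IsStirlingPerm n l})

/-- The list obtained from `l` by inserting two adjacent copies of `m` at position `i`. -/
def insertTwin (m i : ℕ) (l : List ℕ) : List ℕ := l.take i ++ m :: m :: l.drop i

/-- The number of indices `i` for which `a_i` and `a_{i+1}` are related by `R`. -/
def gapCount (R : ℕ → ℕ → Prop) [DecidableRel R] (l : List ℕ) : ℕ :=
  ((Finset.range (l.length + 1)).filter (fun i => R (ext l i) (ext l (i + 1)))).card

/-- The Stirling permutations of length `2 * n`, generated by successive insertions. -/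
def stirlingPerms : ℕ → Finset (List ℕ)
  | 0 => {[]}
  | n + 1 => (stirlingPerms n ×ˢ Finset.range (2 * n + 1)).image
      (fun p => insertTwin (n + 1) p.2 p.1)

theorem isStirlingPerm_iff_sublist {n : ℕ} {l : List ℕ} :
    IsStirlingPerm n l ↔ l.length = 2 * n ∧ (∀ i : ℕ, 1 ≤ i → i ≤ n → l.count i = 2) ∧
      ∀ a b, [a, b, a].Sublist l → a < b := by
  unfold IsStirlingPerm
  refine and_congr_right fun _ => and_congr_right fun _ => ⟨fun h a b hab => ?_, ?_⟩
  · obtain ⟨f, hf⟩ := List.sublist_iff_exists_fin_orderEmbedding_get_eq.1 hab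
    have h0 := hf ⟨0, by simp⟩
    have h1 := hf ⟨1, by simp⟩
    have h2 := hf ⟨2, by simp⟩
    simp only [List.get_eq_getElem, List.getElem_cons_zero, List.getElem_cons_succ] at h0 h1 h2
    have := h (f ⟨0, by simp⟩) (f ⟨1, by simp⟩) (f ⟨2, by simp⟩) (f.lt_iff_lt.2 (by simp))
      (f.lt_iff_lt.2 (by simp)) (by simp only [List.get_eq_getElem]; rw [← h0, ← h2])
    simp only [List.get_eq_getElem] at this
    rwa [← h0, ← h1] at this
  · intro h p q r hpq hqr hpr
    refine h _ _ (List.sublist_iff_exists_fin_orderEmbedding_get_eq.2 ?_)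
    refine ⟨OrderEmbedding.ofStrictMono (![p, q, r] : Fin 3 → Fin l.length) ?_, ?_⟩
    · refine Fin.strictMono_iff_lt_succ.2 fun i => ?_
      fin_cases i
      · exact hpq
      · exact hqr
    · intro i
      change Fin 3 at i
      fin_cases i
      · rfl
      · rfl
      · exact hpr

theorem IsStirlingPerm.mem_Icc {n : ℕ} {l : List ℕ} (h : IsStirlingPerm n l) {x : ℕ}
    (hx : x ∈ l) : x ∈ Finset.Icc 1 n := by
  by_contra hxn
  obtain ⟨hlen, hcount, -⟩ := h
  have hsub : insert x (Finset.Icc 1 n) ⊆ l.toFinset := by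
    intro y hy
    rcases Finset.mem_insert.1 hy with rfl | hy
    · simpa using hx
    · have := hcount y (Finset.mem_Icc.1 hy).1 (Finset.mem_Icc.1 hy).2
      rw [List.mem_toFinset, ← List.count_pos_iff]
      omega
  have hle := Finset.sum_le_sum_of_subset (f := fun a => l.count a) hsub
  rw [List.sum_toFinset_count_eq_length, Finset.sum_insert hxn,
    Finset.sum_congr rfl fun y hy => hcount y (Finset.mem_Icc.1 hy).1 (Finset.mem_Icc.1 hy).2,
    hlen] at hle
  have := List.count_pos_iff.2 hx
  simp at hle
  omega

theorem isStirlingPerm_zero_iff {l : List ℕ} : IsStirlingPerm 0 l ↔ l = [] := by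
  constructor
  · intro h
    simpa using h.1
  · rintro rfl
    exact ⟨rfl, fun i _ _ => by omega, fun p => p.elim0⟩

theorem isStirlingPerm_succ_append_iff {n : ℕ} {u v : List ℕ} (hu : n + 1 ∉ u) (hv : n + 1 ∉ v) :
    IsStirlingPerm (n + 1) (u ++ (n + 1) :: (n + 1) :: v) ↔ IsStirlingPerm n (u ++ v) := by
  have hsub : (u ++ v).Sublist (u ++ (n + 1) :: (n + 1) :: v) :=
    List.Sublist.append_left ((List.sublist_cons_self _ _).trans (List.sublist_cons_self _ _)) u
  constructor
  · intro h
    rw [isStirlingPerm_iff_sublist] at h ⊢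
    obtain ⟨h1, h2, h3⟩ := h
    refine ⟨by simp at h1 ⊢; omega, fun i hi hin => ?_, fun a b hab => h3 a b (hab.trans hsub)⟩
    have := h2 i hi (by omega)
    simpa [List.count_cons, List.count_append, show n + 1 ≠ i by omega] using this
  · intro h
    have hmem := fun x hx => Finset.mem_Icc.1 (h.mem_Icc (x := x) hx)
    rw [isStirlingPerm_iff_sublist] at h ⊢
    obtain ⟨h1, h2, h3⟩ := h
    refine ⟨by simp at h1 ⊢; omega, fun i hi hin => ?_, fun a b hab => ?_⟩
    · rcases Nat.lt_or_ge n i with h | h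
      · obtain rfl : i = n + 1 := by omega
        simp [List.count_append, List.count_eq_zero.2 hu, List.count_eq_zero.2 hv]
      · have := h2 i hi h
        simpa [List.count_cons, List.count_append, show n + 1 ≠ i by omega] using this
    · by_cases ha : a = n + 1
      · subst ha
        exfalso
        have hc := hab.filter (fun x => decide (x = n + 1))
        have hn : ∀ w : List ℕ, n + 1 ∉ w → w.filter (fun x => decide (x = n + 1)) = [] := by
          intro w hw
          refine List.filter_eq_nil_iff.2 fun x hx => ?_
          simp only [decide_eq_true_eq]
          rintro rfl
          exact hw hx
        by_cases hb : b = n + 1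
        · subst hb
          have := hc.length_le
          simp [List.filter_append, hn u hu, hn v hv] at this
        · have hdrop : [n + 1, b, n + 1].Sublist ((n + 1) :: (n + 1) :: v) := by
            obtain ⟨r, s, hrs, hr, hs⟩ := List.sublist_append_iff.1 hab
            cases r with
            | nil => rwa [hrs]
            | cons y r =>
              simp only [List.cons_append, List.cons.injEq] at hrs
              exact absurd (hr.subset (by simp [hrs.1])) hu
          have h4 := List.cons_sublist_cons.1 hdrop
          cases h4 with
          | cons _ h4 => exact hv (h4.subset (by simp))
          | cons_cons _ h4 => exact hb rfl
      · have hau : a ∈ u ++ v := by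
          have := hab.subset (a := a) (by simp)
          simpa [ha] using this
        by_cases hb : b = n + 1
        · have := hmem a hau
          omega
        · have hf : ∀ w : List ℕ, n + 1 ∉ w → w.filter (fun x => decide (x ≠ n + 1)) = w := by
            intro w hw
            refine List.filter_eq_self.2 fun x hx => ?_
            simp only [ne_eq, decide_eq_true_eq]
            rintro rfl
            exact hw hx
          have hc := hab.filter (fun x => decide (x ≠ n + 1))
          rw [List.filter_append, hf u hu] at hc
          simp only [ne_eq, not_true_eq_false, decide_false, Bool.false_eq_true,
            not_false_eq_true, List.filter_cons_of_neg] at hc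
          have hv' := hf v hv
          simp only [ne_eq] at hv'
          rw [hv'] at hc
          exact h3 a b (by simpa [ha, hb] using hc)

theorem IsStirlingPerm.exists_eq_append {n : ℕ} {l : List ℕ} (h : IsStirlingPerm (n + 1) l) :
    ∃ u v, n + 1 ∉ u ∧ n + 1 ∉ v ∧ l = u ++ (n + 1) :: (n + 1) :: v := by
  have hmem := fun x hx => Finset.mem_Icc.1 (h.mem_Icc (x := x) hx)
  obtain ⟨-, h2, h3⟩ := isStirlingPerm_iff_sublist.1 h
  have hc := h2 (n + 1) (by omega) le_rfl
  obtain ⟨u, w, rfl, hu⟩ := List.eq_append_cons_of_mem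
    (List.count_pos_iff.1 (by omega : 0 < l.count (n + 1)))
  simp only [List.count_append, List.count_cons_self, List.count_eq_zero.2 hu] at hc
  cases w with
  | nil => simp at hc
  | cons b v =>
    have hb : b = n + 1 := by
      by_contra hb
      have hv : n + 1 ∈ v := by
        rw [List.count_cons_of_ne hb] at hc
        exact List.count_pos_iff.1 (by omega)
      have := h3 (n + 1) b (List.sublist_append_of_sublist_right
        (((List.singleton_sublist.2 hv).cons_cons b).cons_cons (n + 1)))
      have := hmem b (by simp)
      omega
    subst hb
    refine ⟨u, v, hu, fun hv => ?_, rfl⟩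
    have := List.count_pos_iff.2 hv
    simp only [List.count_cons_self] at hc
    omega

theorem mem_stirlingPerms {n : ℕ} {l : List ℕ} : l ∈ stirlingPerms n ↔ IsStirlingPerm n l := by
  induction n generalizing l with
  | zero => simp [stirlingPerms, isStirlingPerm_zero_iff]
  | succ n ih =>
    simp only [stirlingPerms, Finset.mem_image, Finset.mem_product, ih, Finset.mem_range,
      Prod.exists]
    constructor
    · rintro ⟨l, i, ⟨hl, -⟩, rfl⟩
      have hn : n + 1 ∉ l := fun hx => by
        have := Finset.mem_Icc.1 (hl.mem_Icc hx)
        omega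
      rw [insertTwin, isStirlingPerm_succ_append_iff (fun h => hn (List.mem_of_mem_take h))
        (fun h => hn (List.mem_of_mem_drop h)), List.take_append_drop]
      exact hl
    · intro h
      obtain ⟨u, v, hu, hv, rfl⟩ := h.exists_eq_append
      rw [isStirlingPerm_succ_append_iff hu hv] at h
      have hlen := h.1
      refine ⟨u ++ v, u.length, ⟨h, ?_⟩, by simp [insertTwin]⟩
      rw [List.length_append] at hlen
      omega

theorem insertTwin_injective {m i j : ℕ} {l l' : List ℕ} (hl : m ∉ l) (hl' : m ∉ l')
    (hi : i ≤ l.length) (hj : j ≤ l'.length) (h : insertTwin m i l = insertTwin m j l') :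
    l = l' ∧ i = j := by
  have key : ∀ {k : ℕ} {w : List ℕ}, m ∉ w → k ≤ w.length →
      (insertTwin m k w).idxOf m = k ∧ (insertTwin m k w).erase m = w.take k ++ m :: w.drop k := by
    intro k w hw hk
    have hk' : m ∉ w.take k := fun h => hw (List.mem_of_mem_take h)
    constructor
    · simp [insertTwin, List.idxOf_append_of_notMem hk', hk]
    · simp [insertTwin, List.erase_append_right _ hk']
  have key2 : ∀ {k : ℕ} {w : List ℕ}, m ∉ w → (w.take k ++ m :: w.drop k).erase m = w := by
    intro k w hw
    have hk' : m ∉ w.take k := fun h => hw (List.mem_of_mem_take h)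
    simp [List.erase_append_right _ hk']
  refine ⟨?_, ?_⟩
  · rw [← key2 (k := i) hl, ← key2 (k := j) hl', ← (key hl hi).2, ← (key hl' hj).2, h]
  · rw [← (key hl hi).1, ← (key hl' hj).1, h]

theorem insertTwin_injOn (n : ℕ) :
    Set.InjOn (fun p : List ℕ × ℕ => insertTwin (n + 1) p.2 p.1)
      (stirlingPerms n ×ˢ Finset.range (2 * n + 1) : Finset (List ℕ × ℕ)) := by
  have hn : ∀ l, IsStirlingPerm n l → n + 1 ∉ l := fun l hl hx => by
    have := Finset.mem_Icc.1 (hl.mem_Icc hx)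
    omega
  rintro ⟨l, i⟩ hl ⟨l', j⟩ hl' h
  simp only [Finset.coe_product, Set.mem_prod, Finset.mem_coe, mem_stirlingPerms,
    Finset.mem_range] at hl hl'
  have := insertTwin_injective (hn _ hl.1) (hn _ hl'.1) (by have := hl.1.1; omega)
    (by have := hl'.1.1; omega) h
  exact Prod.ext this.1 this.2

theorem ext_insertTwin_of_le {m i j : ℕ} {l : List ℕ} (hi : i ≤ l.length) (hj : j ≤ i) :
    ext (insertTwin m i l) j = ext l j := by
  rcases j with _ | j
  · simp [ext]
  · simp only [ext, insertTwin, List.getD_eq_getElem?_getD, List.getElem?_append,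
      List.getElem?_take, List.length_take]
    simp [show j < i by omega, show j < l.length by omega]

theorem ext_insertTwin_one {m i : ℕ} {l : List ℕ} (hi : i ≤ l.length) :
    ext (insertTwin m i l) (i + 1) = m := by
  simp [ext, insertTwin, hi]

theorem ext_insertTwin_two {m i : ℕ} {l : List ℕ} (hi : i ≤ l.length) :
    ext (insertTwin m i l) (i + 2) = m := by
  simp [ext, insertTwin, hi]

theorem ext_insertTwin_add {m i k : ℕ} {l : List ℕ} (hi : i ≤ l.length) :
    ext (insertTwin m i l) (i + 3 + k) = ext l (i + 1 + k) := by
  simp only [ext, insertTwin, List.getD_eq_getElem?_getD, List.getElem?_append, List.length_take,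
    min_eq_left hi]
  rw [if_neg (by omega), if_neg (by omega), if_neg (by omega),
    show i + 3 + k - 1 - i = k + 1 + 1 by omega, List.getElem?_cons_succ, List.getElem?_cons_succ,
    List.getElem?_drop, show i + 1 + k - 1 = i + k by omega]

theorem ext_lt {l : List ℕ} {m : ℕ} (hm : 0 < m) (h : ∀ x ∈ l, x < m) (i : ℕ) : ext l i < m := by
  unfold ext
  split_ifs
  · exact hm
  · rcases lt_or_ge (i - 1) l.length with hi | hi
    · rw [List.getD_eq_getElem _ _ hi]
      exact h _ (List.getElem_mem hi)
    · rwa [List.getD_eq_default _ _ hi]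

/-- A relation for which inserting a twin of a new maximum creates exactly one new related gap
among the three gaps it produces. -/
def IsGapKind (R : ℕ → ℕ → Prop) [DecidableRel R] : Prop :=
  ∀ m x y : ℕ, x < m → y < m →
    (if R x m then 1 else 0) + (if R m m then 1 else 0) + (if R m y then 1 else 0) = 1

theorem gapCount_eq_sum (R : ℕ → ℕ → Prop) [DecidableRel R] (l : List ℕ) :
    gapCount R l =
      ∑ i ∈ Finset.range (l.length + 1), if R (ext l i) (ext l (i + 1)) then 1 else 0 := by
  rw [gapCount, Finset.card_filter]

theorem gapCount_insertTwin {R : ℕ → ℕ → Prop} [DecidableRel R] (hR : IsGapKind R) {m i : ℕ}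
    {l : List ℕ} (hm : 0 < m) (hl : ∀ x ∈ l, x < m) (hi : i ≤ l.length) :
    gapCount R (insertTwin m i l) + (if R (ext l i) (ext l (i + 1)) then 1 else 0) =
      gapCount R l + 1 := by
  obtain ⟨k, hk⟩ := Nat.exists_eq_add_of_le hi
  have hlen : (insertTwin m i l).length + 1 = i + (3 + k) := by
    simp [insertTwin]
    omega
  rw [gapCount_eq_sum, gapCount_eq_sum, hlen, show l.length + 1 = i + (1 + k) by omega,
    Finset.sum_range_add, Finset.sum_range_add, Finset.sum_range_add, Finset.sum_range_add]
  have e1 : ∀ j ∈ Finset.range i,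
      (if R (ext (insertTwin m i l) j) (ext (insertTwin m i l) (j + 1)) then 1 else 0) =
        if R (ext l j) (ext l (j + 1)) then 1 else 0 := by
    intro j hj
    rw [Finset.mem_range] at hj
    rw [ext_insertTwin_of_le hi hj.le, ext_insertTwin_of_le hi hj]
  have e2 : ∀ j ∈ Finset.range k,
      (if R (ext (insertTwin m i l) (i + (3 + j))) (ext (insertTwin m i l) (i + (3 + j) + 1))
        then 1 else 0) =
        if R (ext l (i + (1 + j))) (ext l (i + (1 + j) + 1)) then 1 else 0 := by
    intro j hj
    rw [show i + (3 + j) + 1 = i + 3 + (j + 1) by omega, ← add_assoc i 3 j,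
      ext_insertTwin_add hi, ext_insertTwin_add hi, add_assoc, add_assoc, add_assoc, add_assoc]
  rw [Finset.sum_congr rfl e1, Finset.sum_congr rfl e2]
  have h3 := hR m (ext l i) (ext l (i + 1)) (ext_lt hm hl _) (ext_lt hm hl _)
  have e3 : ext (insertTwin m i l) (i + 3) = ext l (i + 1) := ext_insertTwin_add (k := 0) hi
  simp only [Finset.sum_range_succ, Finset.sum_range_zero, add_zero, zero_add, Nat.add_assoc,
    Nat.reduceAdd, ext_insertTwin_of_le hi le_rfl, ext_insertTwin_one hi, ext_insertTwin_two hi, e3]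
  omega

theorem gapCount_le {R : ℕ → ℕ → Prop} [DecidableRel R] {n : ℕ} {l : List ℕ}
    (hl : l ∈ stirlingPerms n) : gapCount R l ≤ 2 * n + 1 := by
  rw [mem_stirlingPerms] at hl
  rw [gapCount, ← hl.1]
  exact (Finset.card_filter_le _ _).trans (by simp)

theorem sum_stirlingPerms_succ {E : Type*} [AddCommMonoid E] {R : ℕ → ℕ → Prop} [DecidableRel R]
    (hR : IsGapKind R) (n : ℕ) (F : ℕ → E) :
    ∑ l ∈ stirlingPerms (n + 1), F (gapCount R l) = ∑ l ∈ stirlingPerms n,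
      (gapCount R l • F (gapCount R l) + (2 * n + 1 - gapCount R l) • F (gapCount R l + 1)) := by
  rw [stirlingPerms, Finset.sum_image (insertTwin_injOn n), Finset.sum_product]
  refine Finset.sum_congr rfl fun l hl => ?_
  rw [mem_stirlingPerms] at hl
  have hlt : ∀ x ∈ l, x < n + 1 := fun x hx => by
    have := Finset.mem_Icc.1 (hl.mem_Icc hx)
    omega
  have hval : ∀ i ∈ Finset.range (2 * n + 1), F (gapCount R (insertTwin (n + 1) i l)) =
      if R (ext l i) (ext l (i + 1)) then F (gapCount R l) else F (gapCount R l + 1) := by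
    intro i hi
    rw [Finset.mem_range] at hi
    have := gapCount_insertTwin hR n.succ_pos hlt (i := i) (by have := hl.1; omega)
    split_ifs with h
    · rw [if_pos h] at this
      rw [Nat.add_right_cancel this]
    · rw [if_neg h, add_zero] at this
      rw [this]
  have hcard := Finset.card_filter_add_card_filter_not (s := Finset.range (2 * n + 1))
    (fun i => R (ext l i) (ext l (i + 1)))
  have hg : ((Finset.range (2 * n + 1)).filter (fun i => R (ext l i) (ext l (i + 1)))).card =
    gapCount R l := by rw [gapCount, hl.1]
  rw [hg, Finset.card_range] at hcard
  rw [Finset.sum_congr rfl hval, Finset.sum_ite, Finset.sum_const, Finset.sum_const, hg,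
    Nat.eq_sub_of_add_eq' hcard]

theorem card_stirlingPerms_pos (n : ℕ) : 0 < (stirlingPerms n).card := by
  refine Finset.card_pos.2 ?_
  induction n with
  | zero => exact ⟨[], by simp [stirlingPerms]⟩
  | succ n ih => exact (ih.product ⟨0, by simp⟩).image _

theorem card_stirlingPerms_succ (n : ℕ) :
    (stirlingPerms (n + 1)).card = (stirlingPerms n).card * (2 * n + 1) := by
  rw [stirlingPerms, Finset.card_image_of_injOn (insertTwin_injOn n), Finset.card_product,
    Finset.card_range]

section Average

variable {E : Type*} [NormedAddCommGroup E] [NormedSpace ℝ E]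

/-- The expectation of `F (gapCount R l)` for a uniformly random Stirling permutation `l`. -/
noncomputable def gapMean (R : ℕ → ℕ → Prop) [DecidableRel R] (n : ℕ) (F : ℕ → E) : E :=
  ((stirlingPerms n).card : ℝ)⁻¹ • ∑ l ∈ stirlingPerms n, F (gapCount R l)

variable {R : ℕ → ℕ → Prop} [DecidableRel R] {n : ℕ}

theorem gapMean_congr {F G : ℕ → E} (h : ∀ k ≤ 2 * n + 1, F k = G k) :
    gapMean R n F = gapMean R n G := by
  unfold gapMean
  rw [Finset.sum_congr rfl fun l hl => h _ (gapCount_le hl)]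

theorem gapMean_const (c : E) : gapMean R n (fun _ => c) = c := by
  have : ((stirlingPerms n).card : ℝ) ≠ 0 := by exact_mod_cast (card_stirlingPerms_pos n).ne'
  rw [gapMean, Finset.sum_const, ← Nat.cast_smul_eq_nsmul ℝ, inv_smul_smul₀ this]

theorem gapMean_sub (F G : ℕ → E) :
    gapMean R n (fun k => F k - G k) = gapMean R n F - gapMean R n G := by
  simp only [gapMean, Finset.sum_sub_distrib, smul_sub]

theorem gapMean_const_mul {A : Type*} [NormedRing A] [NormedAlgebra ℝ A] (c : A) (F : ℕ → A) :
    gapMean R n (fun k => c * F k) = c * gapMean R n F := by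
  simp only [gapMean, ← Finset.mul_sum, mul_smul_comm]

theorem gapMean_add (F G : ℕ → E) :
    gapMean R n (fun k => F k + G k) = gapMean R n F + gapMean R n G := by
  simp only [gapMean, Finset.sum_add_distrib, smul_add]

theorem gapMean_mono {F G : ℕ → ℝ} (h : ∀ k ≤ 2 * n + 1, F k ≤ G k) :
    gapMean R n F ≤ gapMean R n G :=
  mul_le_mul_of_nonneg_left (Finset.sum_le_sum fun _ hl => h _ (gapCount_le hl)) (by positivity)

theorem norm_gapMean_le (F : ℕ → E) : ‖gapMean R n F‖ ≤ gapMean R n (fun k => ‖F k‖) := by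
  rw [gapMean, gapMean, norm_smul, Real.norm_of_nonneg (by positivity), smul_eq_mul]
  exact mul_le_mul_of_nonneg_left (norm_sum_le _ _) (by positivity)

theorem gapMean_succ (hR : IsGapKind R) (F : ℕ → E) :
    gapMean R (n + 1) F = gapMean R n (fun k => ((k : ℝ) / (2 * n + 1)) • F k +
      (1 - (k : ℝ) / (2 * n + 1)) • F (k + 1)) := by
  have hn : (2 * n + 1 : ℝ) ≠ 0 := by positivity
  rw [gapMean, gapMean, sum_stirlingPerms_succ hR, card_stirlingPerms_succ, Nat.cast_mul, mul_inv,
    mul_smul, Finset.smul_sum]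
  congr 1
  refine Finset.sum_congr rfl fun l hl => ?_
  rw [smul_add, ← Nat.cast_smul_eq_nsmul ℝ, ← Nat.cast_smul_eq_nsmul ℝ, smul_smul, smul_smul,
    Nat.cast_sub (gapCount_le hl)]
  push_cast
  congr 2
  · field_simp
  · field_simp

end Average

/-- The deviation of `k` from the mean `(2 * n + 1) / 3` of the number of gaps of a given kind. -/
noncomputable def gapDev (n k : ℕ) : ℝ := k - (2 * n + 1) / 3

theorem gapMean_sq_gapDev_le {R : ℕ → ℕ → Prop} [DecidableRel R] (hR : IsGapKind R) (n : ℕ) :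
    gapMean R n (fun k => gapDev n k ^ 2) ≤ n + 1 := by
  induction n with
  | zero =>
    refine (gapMean_mono (G := fun _ => 1) fun k hk => ?_).trans ?_
    · have hk' : (k : ℝ) ≤ 1 := by exact_mod_cast hk
      have : (0 : ℝ) ≤ k := k.cast_nonneg
      simp only [gapDev, Nat.cast_zero]
      nlinarith
    · rw [gapMean_const]
      simp
  | succ n ih =>
    rw [gapMean_succ hR]
    refine (gapMean_mono (G := fun k => gapDev n k ^ 2 + 1) fun k hk => ?_).trans ?_
    · have hk' : (k : ℝ) ≤ 2 * n + 1 := by exact_mod_cast hk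
      have hN : (0 : ℝ) < 2 * n + 1 := by positivity
      set N : ℝ := 2 * n + 1 with hNdef
      obtain ⟨q, hq⟩ : ∃ q, q = (k : ℝ) / N := ⟨_, rfl⟩
      have hkq : (k : ℝ) = N * q := by rw [hq]; field_simp
      have hq1 : q ≤ 1 := by rw [hq]; exact (div_le_one hN).2 hk'
      have e1 : gapDev (n + 1) k = gapDev n k - 2 / 3 := by
        simp only [gapDev]; push_cast; ring
      have e2 : gapDev (n + 1) (k + 1) = gapDev n k + 1 / 3 := by
        simp only [gapDev]; push_cast; ring
      have e3 : gapDev n k = N * (q - 1 / 3) := by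
        simp only [gapDev, ← hNdef, hkq]; ring
      rw [e1, e2, ← hq, smul_eq_mul, smul_eq_mul, e3]
      nlinarith [mul_nonneg hN.le (sq_nonneg (q - 1 / 3))]
    · rw [gapMean_add, gapMean_const]
      push_cast
      linarith

theorem gapMean_abs_gapDev_le {R : ℕ → ℕ → Prop} [DecidableRel R] (hR : IsGapKind R) (n : ℕ) :
    gapMean R n (fun k => |gapDev n k / (2 * n + 1)|) ≤ 1 / √(n + 1) := by
  have hr : 0 < √((n : ℝ) + 1) := Real.sqrt_pos.2 (by positivity)
  have hr2 : √((n : ℝ) + 1) ^ 2 = n + 1 := Real.sq_sqrt (by positivity)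
  set r := √((n : ℝ) + 1)
  have hN : r ^ 2 ≤ 2 * n + 1 := by
    have : (0 : ℝ) ≤ n := n.cast_nonneg
    linarith
  have key : ∀ k ≤ 2 * n + 1, |gapDev n k / (2 * n + 1)| ≤
      (1 / (2 * r ^ 3)) * gapDev n k ^ 2 + 1 / (2 * r) := by
    intro k _
    rw [abs_div, abs_of_pos (show (0 : ℝ) < 2 * n + 1 by positivity)]
    calc |gapDev n k| / (2 * n + 1) ≤ |gapDev n k| / r ^ 2 := by gcongr
      _ ≤ _ := by
        rw [← sq_abs (gapDev n k), ← sub_nonneg]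
        have : 1 / (2 * r ^ 3) * |gapDev n k| ^ 2 + 1 / (2 * r) - |gapDev n k| / r ^ 2 =
          1 / (2 * r ^ 3) * (|gapDev n k| - r) ^ 2 := by
          field_simp
          ring
        rw [this]
        positivity
  refine (gapMean_mono key).trans ?_
  rw [gapMean_add, gapMean_const, gapMean_const_mul]
  calc _ ≤ 1 / (2 * r ^ 3) * r ^ 2 + 1 / (2 * r) := by
        rw [hr2]
        gcongr
        exact gapMean_sq_gapDev_le hR n
    _ = 1 / r := by
      field_simp
      ring

open Complex in
theorem norm_exp_mul_I_sub_quadratic_le {x : ℝ} (hx : |x| ≤ 1) :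
    ‖exp (x * I) - (1 + x * I - x ^ 2 / 2)‖ ≤ |x| ^ 3 / 4 := by
  have hn : ‖(x * I : ℂ)‖ = |x| := by simp
  have h := Complex.exp_bound (x := x * I) (by rwa [hn]) (n := 3) (by norm_num)
  rw [hn] at h
  simp only [Finset.sum_range_succ, Finset.sum_range_zero, Nat.factorial, mul_pow, I_sq] at h
  norm_num at h
  have e : (1 + x * I - x ^ 2 / 2 : ℂ) = 1 + x * I + -(x : ℂ) ^ 2 / 2 := by ring
  rw [e]
  refine h.trans ?_
  have : 0 ≤ |x| ^ 3 := by positivity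
  linarith

open Complex in
theorem norm_centered_bernoulli_charFun_sub_le {t q : ℝ} (ht : |t| ≤ 1) (hq0 : 0 ≤ q)
    (hq1 : q ≤ 1) :
    ‖(q : ℂ) * exp ((t * (q - 1) : ℝ) * I) + (1 - q) * exp ((t * q : ℝ) * I) -
      (1 - t ^ 2 / 9)‖ ≤ |t| ^ 3 + t ^ 2 * |q - 1 / 3| := by
  have habs : |q - 1| ≤ 1 := by rw [abs_le]; constructor <;> linarith
  have habs' : |q| ≤ 1 := by rw [abs_le]; constructor <;> linarith
  have aux : ∀ y : ℝ, |y| ≤ 1 →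
      ‖exp ((t * y : ℝ) * I) - (1 + (t * y : ℝ) * I - (t * y : ℝ) ^ 2 / 2)‖ ≤ |t| ^ 3 / 4 := by
    intro y hy
    have h1 : |t * y| ≤ |t| := by
      rw [abs_mul]
      exact mul_le_of_le_one_right (abs_nonneg t) hy
    refine (norm_exp_mul_I_sub_quadratic_le (h1.trans ht)).trans ?_
    gcongr
  have h1 := aux _ habs
  have h2 := aux _ habs'
  set A := exp ((t * (q - 1) : ℝ) * I) - (1 + (t * (q - 1) : ℝ) * I - (t * (q - 1) : ℝ) ^ 2 / 2)
    with hA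
  set B := exp ((t * q : ℝ) * I) - (1 + (t * q : ℝ) * I - (t * q : ℝ) ^ 2 / 2) with hB
  have e : (q : ℂ) * exp ((t * (q - 1) : ℝ) * I) + (1 - q) * exp ((t * q : ℝ) * I) -
      (1 - t ^ 2 / 9) = (q : ℂ) * A + ((1 - q : ℝ) : ℂ) * B +
        ((t ^ 2 / 2 * ((q - 1 / 3) * (q - 2 / 3)) : ℝ) : ℂ) := by
    rw [hA, hB]
    push_cast
    ring
  rw [e]
  refine (norm_add_le _ _).trans (add_le_add ?_ ?_)
  · refine (norm_add_le _ _).trans ?_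
    rw [norm_mul, norm_mul, norm_real, norm_real, Real.norm_of_nonneg hq0,
      Real.norm_of_nonneg (sub_nonneg.2 hq1)]
    have : 0 ≤ |t| ^ 3 := by positivity
    nlinarith
  · rw [norm_real, Real.norm_eq_abs, abs_mul, abs_mul, abs_of_nonneg (by positivity)]
    have h3 : |q - 2 / 3| ≤ 2 := by rw [abs_le]; constructor <;> linarith
    have : 0 ≤ t ^ 2 * |q - 1 / 3| := by positivity
    nlinarith

/-- The characteristic function of the centred number of gaps of kind `R`. -/
noncomputable def gapCharFun (R : ℕ → ℕ → Prop) [DecidableRel R] (n : ℕ) (t : ℝ) : ℂ :=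
  gapMean R n (fun k => Complex.exp ((t * gapDev n k : ℝ) * Complex.I))

/-- The factor by which the expected deviation contracts at each insertion. -/
noncomputable def gapContraction (n : ℕ) : ℝ := 2 * n / (2 * n + 1)

theorem gapContraction_nonneg (n : ℕ) : 0 ≤ gapContraction n := by
  unfold gapContraction; positivity

theorem gapContraction_le_one (n : ℕ) : gapContraction n ≤ 1 := by
  unfold gapContraction
  rw [div_le_one (by positivity)]
  linarith

open Complex in
theorem norm_gapCharFun_succ_sub_le {R : ℕ → ℕ → Prop} [DecidableRel R] (hR : IsGapKind R) (n : ℕ)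
    {t : ℝ} (ht : |t| ≤ 1) :
    ‖gapCharFun R (n + 1) t - (1 - t ^ 2 / 9) * gapCharFun R n (gapContraction n * t)‖ ≤
      |t| ^ 3 + t ^ 2 * (1 / √(n + 1)) := by
  rw [gapCharFun, gapCharFun, gapMean_succ hR, ← gapMean_const_mul, ← gapMean_sub]
  refine (norm_gapMean_le _).trans ?_
  refine (gapMean_mono (G := fun k => |t| ^ 3 + t ^ 2 * |gapDev n k / (2 * n + 1)|)
    fun k hk => ?_).trans ?_
  · have hk' : (k : ℝ) ≤ 2 * n + 1 := by exact_mod_cast hk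
    have hN : (0 : ℝ) < 2 * n + 1 := by positivity
    obtain ⟨q, hq⟩ : ∃ q, q = (k : ℝ) / (2 * n + 1) := ⟨_, rfl⟩
    have hkq : (k : ℝ) = (2 * n + 1) * q := by rw [hq]; field_simp
    have hq0 : 0 ≤ q := by rw [hq]; positivity
    have hq1 : q ≤ 1 := by rw [hq]; exact (div_le_one hN).2 hk'
    have e0 : gapDev n k / (2 * n + 1) = q - 1 / 3 := by
      simp only [gapDev, hkq]; field_simp
    have e1 : t * gapDev (n + 1) k = gapContraction n * t * gapDev n k + t * (q - 1) := by
      simp only [gapDev, gapContraction, hkq]; push_cast; field_simp; ring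
    have e2 : t * gapDev (n + 1) (k + 1) = gapContraction n * t * gapDev n k + t * q := by
      simp only [gapDev, gapContraction, Nat.cast_add, hkq]; push_cast; field_simp; ring
    rw [e0, e1, e2, ← hq, ofReal_add _ (t * (q - 1)), ofReal_add _ (t * q), add_mul, add_mul,
      exp_add, exp_add]
    set Z := exp ((gapContraction n * t * gapDev n k : ℝ) * I) with hZ
    have hZn : ‖Z‖ = 1 := norm_exp_ofReal_mul_I _
    have e : q • (Z * exp ((t * (q - 1) : ℝ) * I)) + (1 - q) • (Z * exp ((t * q : ℝ) * I)) -
        (1 - t ^ 2 / 9) * Z = Z * ((q : ℂ) * exp ((t * (q - 1) : ℝ) * I) +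
          (1 - q) * exp ((t * q : ℝ) * I) - (1 - t ^ 2 / 9)) := by
      rw [real_smul, real_smul, Complex.ofReal_sub, Complex.ofReal_one]
      ring
    rw [e, norm_mul, hZn, one_mul]
    exact norm_centered_bernoulli_charFun_sub_le ht hq0 hq1
  · rw [gapMean_add, gapMean_const, gapMean_const_mul]
    gcongr
    exact gapMean_abs_gapDev_le hR n

theorem abs_exp_neg_sub_exp_neg_le {a b : ℝ} (ha : 0 ≤ a) (hb : 0 ≤ b) :
    |Real.exp (-a) - Real.exp (-b)| ≤ |a - b| := by
  wlog h : a ≤ b generalizing a b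
  · rw [abs_sub_comm, abs_sub_comm a]
    exact this hb ha (le_of_not_ge h)
  rw [abs_of_nonneg (sub_nonneg.2 (Real.exp_le_exp.2 (neg_le_neg h))), abs_sub_comm,
    abs_of_nonneg (sub_nonneg.2 h)]
  have h1 : Real.exp (-b) = Real.exp (-a) * Real.exp (a - b) := by
    rw [← Real.exp_add]; ring_nf
  have h2 := Real.add_one_le_exp (a - b)
  have h3 : Real.exp (-a) ≤ 1 := Real.exp_le_one_iff.2 (by linarith)
  have h4 := Real.exp_pos (-a)
  rw [h1]
  nlinarith

theorem abs_gaussian_succ_sub_le (n : ℕ) {t : ℝ} (ht : |t| ≤ 1) :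
    |Real.exp (-((n + 1 : ℕ) * t ^ 2 / 18)) -
      (1 - t ^ 2 / 9) * Real.exp (-(n * (gapContraction n * t) ^ 2 / 18))| ≤
      |t| ^ 3 + t ^ 2 * (1 / √(n + 1)) := by
  have ht2 : t ^ 2 ≤ 1 := by rw [← sq_abs]; exact pow_le_one₀ (abs_nonneg t) ht
  have hN : (0 : ℝ) < 2 * n + 1 := by positivity
  set u := n * (gapContraction n * t) ^ 2 / 18 with hu
  have hu0 : 0 ≤ u := by positivity
  have h1 : |Real.exp (-(t ^ 2 / 9)) - 1 + t ^ 2 / 9| ≤ |t| ^ 3 := by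
    have := Real.abs_exp_sub_one_sub_id_le (x := -(t ^ 2 / 9)) (by
      rw [abs_neg, abs_of_nonneg (by positivity)]; linarith)
    rw [sub_neg_eq_add] at this
    refine this.trans ?_
    have h4 : |t| ^ 4 ≤ |t| ^ 3 := pow_le_pow_of_le_one (abs_nonneg t) ht (by norm_num)
    have h5 : (-(t ^ 2 / 9)) ^ 2 = |t| ^ 4 / 81 := by
      rw [show |t| ^ 4 = (|t| ^ 2) ^ 2 by ring, sq_abs]; ring
    have : 0 ≤ |t| ^ 4 := by positivity
    linarith
  have h2 : |Real.exp (-((n + 1 : ℕ) * t ^ 2 / 18)) - Real.exp (-(u + t ^ 2 / 9))| ≤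
      t ^ 2 * (1 / √(n + 1)) := by
    refine (abs_exp_neg_sub_exp_neg_le (by positivity) (by positivity)).trans ?_
    have e : ((n + 1 : ℕ) * t ^ 2 / 18) - (u + t ^ 2 / 9) =
        -(t ^ 2 * ((3 * n + 1) / (18 * (2 * n + 1) ^ 2))) := by
      rw [hu, gapContraction]
      push_cast
      field_simp
      ring
    rw [e, abs_neg, abs_of_nonneg (by positivity)]
    refine mul_le_mul_of_nonneg_left ?_ (sq_nonneg t)
    have hs : √((n : ℝ) + 1) ≤ n + 1 := by
      have h0 : (0 : ℝ) ≤ n := n.cast_nonneg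
      rw [Real.sqrt_le_left (by positivity)]
      nlinarith
    refine le_trans ?_ (one_div_le_one_div_of_le (Real.sqrt_pos.2 (by positivity)) hs)
    rw [div_le_div_iff₀ (by positivity) (by positivity)]
    have h0 : (0 : ℝ) ≤ n := n.cast_nonneg
    nlinarith
  have e : Real.exp (-((n + 1 : ℕ) * t ^ 2 / 18)) - (1 - t ^ 2 / 9) * Real.exp (-u) =
      Real.exp (-u) * (Real.exp (-(t ^ 2 / 9)) - 1 + t ^ 2 / 9) +
      (Real.exp (-((n + 1 : ℕ) * t ^ 2 / 18)) - Real.exp (-(u + t ^ 2 / 9))) := by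
    rw [neg_add, Real.exp_add]
    ring
  rw [e]
  refine (abs_add_le _ _).trans (add_le_add ?_ h2)
  rw [abs_mul, abs_of_pos (Real.exp_pos _)]
  exact (mul_le_of_le_one_left (abs_nonneg _) (Real.exp_le_one_iff.2 (by linarith))).trans h1

theorem norm_gapCharFun_sub_gaussian_le {R : ℕ → ℕ → Prop} [DecidableRel R] (hR : IsGapKind R)
    (n : ℕ) {t : ℝ} (ht : |t| ≤ 1) :
    ‖gapCharFun R n t - (Real.exp (-(n * t ^ 2 / 18)) : ℝ)‖ ≤
      |t| + 2 * n * |t| ^ 3 + 2 * t ^ 2 * ∑ k ∈ Finset.range n, 1 / √((k : ℝ) + 1) := by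
  induction n generalizing t with
  | zero =>
    have e : gapCharFun R 0 t - (Real.exp (-((0 : ℕ) * t ^ 2 / 18)) : ℝ) = gapMean R 0
        (fun k => Complex.exp ((t * gapDev 0 k : ℝ) * Complex.I) - 1) := by
      rw [gapMean_sub, gapMean_const, gapCharFun]
      simp
    rw [e]
    refine (norm_gapMean_le _).trans ?_
    refine (gapMean_mono (G := fun _ => |t|) fun k hk => ?_).trans (by simp [gapMean_const])
    have hk' : (k : ℝ) ≤ 1 := by exact_mod_cast hk
    have hk0 : (0 : ℝ) ≤ k := k.cast_nonneg
    rw [mul_comm]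
    refine Real.norm_exp_I_mul_ofReal_sub_one_le.trans ?_
    rw [Real.norm_eq_abs, abs_mul]
    refine mul_le_of_le_one_right (abs_nonneg t) ?_
    rw [gapDev, abs_le]
    constructor <;> push_cast <;> linarith
  | succ n ih =>
    have ha0 := gapContraction_nonneg n
    have ha1 := gapContraction_le_one n
    have hat : |gapContraction n * t| ≤ |t| := by
      rw [abs_mul, abs_of_nonneg ha0]
      exact mul_le_of_le_one_left (abs_nonneg t) ha1
    have hat2 : (gapContraction n * t) ^ 2 ≤ t ^ 2 := sq_le_sq.2 hat
    have ht2 : t ^ 2 ≤ 1 := by rw [← sq_abs]; exact pow_le_one₀ (abs_nonneg t) ht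
    have h1 := norm_gapCharFun_succ_sub_le hR n ht
    have h2 := abs_gaussian_succ_sub_le n ht
    have h3 := ih (hat.trans ht)
    have hS : 0 ≤ ∑ k ∈ Finset.range n, 1 / √((k : ℝ) + 1) :=
      Finset.sum_nonneg fun _ _ => by positivity
    have h3' : ‖gapCharFun R n (gapContraction n * t) -
        (Real.exp (-(n * (gapContraction n * t) ^ 2 / 18)) : ℝ)‖ ≤
        |t| + 2 * n * |t| ^ 3 + 2 * t ^ 2 * ∑ k ∈ Finset.range n, 1 / √((k : ℝ) + 1) := by
      refine h3.trans ?_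
      gcongr
    set φ := gapCharFun R n (gapContraction n * t)
    set g := Real.exp (-(n * (gapContraction n * t) ^ 2 / 18))
    set g' := Real.exp (-((n + 1 : ℕ) * t ^ 2 / 18))
    have e : gapCharFun R (n + 1) t - (g' : ℂ) =
        (gapCharFun R (n + 1) t - (1 - t ^ 2 / 9) * φ) + ((1 - t ^ 2 / 9 : ℝ) : ℂ) * (φ - g) -
          ((g' - (1 - t ^ 2 / 9) * g : ℝ) : ℂ) := by
      push_cast
      ring
    rw [e]
    refine (norm_sub_le _ _).trans ?_
    rw [Complex.norm_real, Real.norm_eq_abs]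
    have h4 := norm_add_le (gapCharFun R (n + 1) t - (1 - t ^ 2 / 9) * φ)
      (((1 - t ^ 2 / 9 : ℝ) : ℂ) * (φ - g))
    rw [norm_mul, Complex.norm_real, Real.norm_of_nonneg (by linarith)] at h4
    have h5 : (1 - t ^ 2 / 9) * ‖φ - g‖ ≤ ‖φ - g‖ :=
      mul_le_of_le_one_left (norm_nonneg _) (by linarith [sq_nonneg t])
    rw [Finset.sum_range_succ]
    rw [Nat.cast_succ]
    linarith

theorem setOf_isStirlingPerm_eq (n : ℕ) :
    {l : List ℕ | IsStirlingPerm n l} = ↑(stirlingPerms n) :=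
  Set.ext fun _ => mem_stirlingPerms.symm

instance discreteMeasurableSpace_listNat : DiscreteMeasurableSpace (List ℕ) := ⟨fun _ => trivial⟩

theorem integral_uniformStirling {E : Type*} [NormedAddCommGroup E] [NormedSpace ℝ E]
    [CompleteSpace E] (n : ℕ) (G : List ℕ → E) :
    ∫ l, G l ∂(uniformStirling n) =
      ((stirlingPerms n).card : ℝ)⁻¹ • ∑ l ∈ stirlingPerms n, G l := by
  rw [uniformStirling, setOf_isStirlingPerm_eq, Set.ncard_coe_finset, integral_smul_measure,
    setIntegral_finset]
  · simp [Measure.real]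
  · rw [← (stirlingPerms n : Set (List ℕ)).biUnion_of_singleton]
    simp [integrableOn_finset_iUnion]

instance isProbabilityMeasure_uniformStirling (n : ℕ) :
    IsProbabilityMeasure (uniformStirling n) := by
  constructor
  have h : ((stirlingPerms n).card : ℝ≥0∞) ≠ 0 := by
    exact_mod_cast (card_stirlingPerms_pos n).ne'
  rw [uniformStirling, setOf_isStirlingPerm_eq, Set.ncard_coe_finset, Measure.smul_apply,
    Measure.restrict_apply_univ, Measure.count_apply_finset, smul_eq_mul,
    ENNReal.inv_mul_cancel h (ENNReal.natCast_ne_top _)]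

theorem tendsto_inv_sqrt_natCast :
    Filter.Tendsto (fun n : ℕ => 1 / √(n : ℝ)) Filter.atTop (nhds 0) := by
  simp only [one_div]
  exact tendsto_inv_atTop_zero.comp
    (Real.tendsto_sqrt_atTop.comp tendsto_natCast_atTop_atTop)

theorem tendsto_gapCharFun {R : ℕ → ℕ → Prop} [DecidableRel R] (hR : IsGapKind R) (s : ℝ) :
    Filter.Tendsto (fun n : ℕ => gapCharFun R n (s / √n)) Filter.atTop
      (nhds (Real.exp (-(s ^ 2 / 18)) : ℝ)) := by
  have hu := tendsto_inv_sqrt_natCast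
  have hc : Filter.Tendsto (fun n : ℕ => (n : ℝ)⁻¹ * ∑ k ∈ Finset.range n, 1 / √((k : ℝ) + 1))
      Filter.atTop (nhds 0) := by
    refine Filter.Tendsto.cesaro ?_
    have := hu.comp (Filter.tendsto_add_atTop_nat 1)
    simpa [Function.comp_def] using this
  rw [tendsto_iff_norm_sub_tendsto_zero]
  have hlim : Filter.Tendsto (fun n : ℕ => |s| * (1 / √n) + 2 * |s| ^ 3 * (1 / √n) +
      2 * s ^ 2 * ((n : ℝ)⁻¹ * ∑ k ∈ Finset.range n, 1 / √((k : ℝ) + 1)))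
      Filter.atTop (nhds 0) := by
    simpa using ((hu.const_mul |s|).add (hu.const_mul (2 * |s| ^ 3))).add
      (hc.const_mul (2 * s ^ 2))
  have hsmall : ∀ᶠ n : ℕ in Filter.atTop, |s| * (1 / √(n : ℝ)) ≤ 1 := by
    have := hu.const_mul |s|
    rw [mul_zero] at this
    exact this.eventually_le_const zero_lt_one
  refine squeeze_zero' (Filter.Eventually.of_forall fun _ => norm_nonneg _) ?_ hlim
  filter_upwards [hsmall, Filter.eventually_gt_atTop 0] with n hn hn0
  have hr : 0 < √(n : ℝ) := Real.sqrt_pos.2 (by exact_mod_cast hn0)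
  have hr2 : √(n : ℝ) ^ 2 = n := Real.sq_sqrt n.cast_nonneg
  have habs : |s / √n| = |s| * (1 / √n) := by
    rw [abs_div, abs_of_pos hr]
    ring
  have h := norm_gapCharFun_sub_gaussian_le hR n (habs.trans_le hn)
  have e : (n : ℝ) * (s / √n) ^ 2 / 18 = s ^ 2 / 18 := by
    rw [div_pow, hr2]
    field_simp
  rw [e] at h
  refine h.trans (le_of_eq ?_)
  rw [habs, div_pow, hr2]
  generalize ∑ k ∈ Finset.range n, 1 / √((k : ℝ) + 1) = S
  generalize √(n : ℝ) = r at hr hr2 ⊢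
  rw [← hr2]
  field_simp

theorem tendsto_integral_gapCount {R : ℕ → ℕ → Prop} [DecidableRel R] (hR : IsGapKind R)
    (f : BoundedContinuousFunction ℝ ℝ) :
    Filter.Tendsto
      (fun n : ℕ => ∫ l, f (((gapCount R l : ℝ) - 2 * n / 3) / √n) ∂(uniformStirling n))
      Filter.atTop (nhds (∫ x, f x ∂(gaussianReal 0 (1 / 9)))) := by
  have hX : ∀ n : ℕ, Measurable (fun l : List ℕ => ((gapCount R l : ℝ) - 2 * n / 3) / √n) :=
    fun n => .of_discrete
  let μ : ℕ → ProbabilityMeasure ℝ := fun n =>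
    ⟨(uniformStirling n).map (fun l : List ℕ => ((gapCount R l : ℝ) - 2 * n / 3) / √n),
      Measure.isProbabilityMeasure_map (hX n).aemeasurable⟩
  let ν : ProbabilityMeasure ℝ := ⟨gaussianReal 0 (1 / 9), inferInstance⟩
  have hμ : Filter.Tendsto μ Filter.atTop (nhds ν) := by
    rw [ProbabilityMeasure.tendsto_iff_tendsto_charFun]
    intro s
    have hchar : ∀ n, charFun (μ n) s =
        Complex.exp ((s / 3 * (1 / √n) : ℝ) * Complex.I) * gapCharFun R n (s / √n) := by
      intro n
      simp only [μ, ProbabilityMeasure.coe_mk]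
      rw [charFun_apply_real, integral_map (hX n).aemeasurable (by fun_prop),
        integral_uniformStirling, gapCharFun, ← gapMean_const_mul, gapMean]
      congr 1
      refine Finset.sum_congr rfl fun l _ => ?_
      rw [← Complex.exp_add, ← add_mul]
      congr 2
      norm_cast
      rw [gapDev]
      push_cast
      ring
    have hν : charFun ν s = ((1 : ℂ) * (Real.exp (-(s ^ 2 / 18)) : ℝ)) := by
      simp only [ν, ProbabilityMeasure.coe_mk]
      rw [charFun_gaussianReal, one_mul, Complex.ofReal_exp]
      congr 1
      push_cast
      ring
    simp only [hchar]
    rw [hν]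
    refine Filter.Tendsto.mul ?_ (tendsto_gapCharFun hR s)
    have h0 := tendsto_inv_sqrt_natCast.const_mul (s / 3)
    rw [mul_zero] at h0
    have hcont : Continuous fun x : ℝ => Complex.exp (x * Complex.I) := by fun_prop
    simpa [Function.comp_def] using (hcont.tendsto 0).comp h0
  have h := ProbabilityMeasure.tendsto_iff_forall_integral_tendsto.1 hμ f
  refine h.congr fun n => ?_
  simp only [μ, ProbabilityMeasure.coe_mk]
  exact integral_map (hX n).aemeasurable f.continuous.aestronglyMeasurable

theorem isGapKind_lt : IsGapKind (· < ·) := by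
  intro m x y hx hy
  simp [hx, hy.not_gt]

theorem isGapKind_gt : IsGapKind (· > ·) := by
  intro m x y hx hy
  simp [hx.not_gt, hy]

theorem isGapKind_eq : IsGapKind (· = ·) := by
  intro m x y hx hy
  simp [hx.ne, hy.ne']

/-- As `n → ∞`, `(Z_n - 2n/3)/√n` converges in distribution to `N(0, 1/9)`, where
`Z_n` is the number of plateaux of a uniformly random Stirling permutation of length
`2n`; the same holds for the numbers `X_n` of ascents and `Y_n` of descents.
Convergence in distribution is expressed by convergence of the integrals of every
bounded continuous function `f : ℝ → ℝ`. -/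
theorem clt_ascents_descents_plateaux (f : BoundedContinuousFunction ℝ ℝ) :
    Filter.Tendsto
      (fun n : ℕ => ∫ l, f (((ascents l : ℝ) - 2 * n / 3) / Real.sqrt n)
        ∂(uniformStirling n))
      Filter.atTop (nhds (∫ x, f x ∂(gaussianReal 0 (1 / 9)))) ∧
    Filter.Tendsto
      (fun n : ℕ => ∫ l, f (((descents l : ℝ) - 2 * n / 3) / Real.sqrt n)
        ∂(uniformStirling n))
      Filter.atTop (nhds (∫ x, f x ∂(gaussianReal 0 (1 / 9)))) ∧
    Filter.Tendsto
      (fun n : ℕ => ∫ l, f (((plateaux l : ℝ) - 2 * n / 3) / Real.sqrt n)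
        ∂(uniformStirling n))
      Filter.atTop (nhds (∫ x, f x ∂(gaussianReal 0 (1 / 9)))) := by
  exact ⟨tendsto_integral_gapCount isGapKind_lt f, tendsto_integral_gapCount isGapKind_gt f,
    tendsto_integral_gapCount isGapKind_eq f⟩
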